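/- Let N ≥ 2 be an even integer and k = N/2. Then for every v ∈ X_1 and every r ∈ (0,1), |v(r)| ≤ ‖v‖_{X_1} · (−(N/μ_N)·ln r)^{N/(N+2)}. -/

import Mathlib

open MeasureTheory Real Set Filter
open scoped ENNReal

/-- Surface area of the unit sphere in `ℝ^N` (equals `N` times the volume of the unit ball). -/
noncomputable def omegaS (N : ℕ) : ℝ :=
  N * (volume (Metric.ball (0 : EuclideanSpace ℝ (Fin N)) 1)).toReal

/-- The normalising constant `c_N = ω_{N-1} · binom(N,k) / N`. -/
noncomputable def cN (N k : ℕ) : ℝ := omegaS N * (N.choose k) / N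

/-- The critical constant `μ_N = N · (ω_{N-1} · binom(N-1,k-1) / k)^{2/N}`. -/
noncomputable def muN (N k : ℕ) : ℝ :=
  N * (omegaS N * ((N - 1).choose (k - 1)) / k) ^ ((2 : ℝ) / N)

/-- Membership in the weighted space `X₁`: `v` is locally absolutely continuous on `(0,1)`
with derivative `v'` (in the sense of the fundamental theorem of calculus),
`v(r) → 0` as `r → 1⁻`, and the two defining weighted integrals are finite. -/
structure MemX1 (N k : ℕ) (v v' : ℝ → ℝ) : Prop where
  locAC : ∀ a ∈ Ioo (0:ℝ) 1, ∀ b ∈ Ioo (0:ℝ) 1,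
    IntervalIntegrable v' volume a b ∧ v b - v a = ∫ t in a..b, v' t
  lim_one : Tendsto v (nhdsWithin 1 (Iio 1)) (nhds 0)
  grad_int : ∫⁻ r in Ioo (0:ℝ) 1, ENNReal.ofReal (r ^ (N - k) * |v' r| ^ (k + 1)) < ⊤
  fun_int : ∫⁻ r in Ioo (0:ℝ) 1, ENNReal.ofReal (r ^ (N - 1) * |v r| ^ (k + 1)) < ⊤

/-- The norm on `X₁`: `‖v‖ = (c_N ∫₀¹ r^{N-k} |v'|^{k+1} dr)^{1/(k+1)}`. -/
noncomputable def normX1 (N k : ℕ) (v' : ℝ → ℝ) : ℝ :=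
  (cN N k * ∫ r in Ioo (0:ℝ) 1, r ^ (N - k) * |v' r| ^ (k + 1)) ^ (1 / (k + 1 : ℝ))

theorem omegaS_pos {N : ℕ} (hN : 0 < N) : 0 < omegaS N := by
  unfold omegaS
  have : 0 < (volume (Metric.ball (0 : EuclideanSpace ℝ (Fin N)) 1)).toReal :=
    ENNReal.toReal_pos (Metric.measure_ball_pos volume _ one_pos).ne' measure_ball_lt_top.ne
  positivity

theorem cN_pos {N k : ℕ} (hN : 0 < N) (hkN : k ≤ N) : 0 < cN N k := by
  have h1 := omegaS_pos hN
  have h2 : 0 < N.choose k := Nat.choose_pos hkN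
  unfold cN
  positivity

/-- The base of the power in `μ_N` is exactly `c_N`. -/
theorem muN_eq_cN {N k : ℕ} (hk : 0 < k) (hN : 0 < N) :
    muN N k = N * cN N k ^ ((2 : ℝ) / N) := by
  unfold muN cN
  have h : N * (N - 1).choose (k - 1) = N.choose k * k := by
    have := Nat.add_one_mul_choose_eq (N - 1) (k - 1)
    rwa [Nat.sub_add_cancel hN, Nat.sub_add_cancel hk] at this
  have h' : (N : ℝ) * (N - 1).choose (k - 1) = N.choose k * k := by exact_mod_cast h
  have hk' : (k : ℝ) ≠ 0 := by positivity
  have hN' : (N : ℝ) ≠ 0 := by positivity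
  congr 2
  field_simp
  linear_combination omegaS N * h'

theorem MemX1.aestronglyMeasurable_deriv {N k : ℕ} {v v' : ℝ → ℝ} (hv : MemX1 N k v v') :
    AEStronglyMeasurable v' (volume.restrict (Ioo (0 : ℝ) 1)) := by
  have h : LocallyIntegrableOn v' (Ioo (0 : ℝ) 1) volume := by
    rintro x ⟨h0, h1⟩
    have hi := (hv.locAC (x / 2) ⟨by linarith, by linarith⟩ ((1 + x) / 2)
      ⟨by linarith, by linarith⟩).1
    rw [intervalIntegrable_iff_integrableOn_Ioc_of_le (by linarith)] at hi
    exact ⟨_, mem_nhdsWithin_of_mem_nhds (Ioc_mem_nhds (by linarith) (by linarith)), hi⟩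
  exact h.aestronglyMeasurable

theorem MemX1.integrableOn_grad {N k : ℕ} {v v' : ℝ → ℝ} (hv : MemX1 N k v v') :
    IntegrableOn (fun r => r ^ (N - k) * |v' r| ^ (k + 1)) (Ioo (0 : ℝ) 1) := by
  refine ⟨?_, ?_⟩
  · have h1 : AEStronglyMeasurable (fun r : ℝ => r ^ (N - k)) (volume.restrict (Ioo (0 : ℝ) 1)) :=
      (continuous_pow _).aestronglyMeasurable
    exact h1.mul (hv.aestronglyMeasurable_deriv.norm.pow (k + 1))
  · rw [hasFiniteIntegral_iff_ofReal]
    · exact hv.grad_int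
    · filter_upwards [ae_restrict_mem measurableSet_Ioo] with r hr
      have := hr.1.le
      positivity

/-- Weighted Hölder inequality with the logarithmic dual weight. -/
theorem setIntegral_abs_le_log {k : ℕ} (hk : 0 < k) {f : ℝ → ℝ} {r s : ℝ} (hr : 0 < r)
    (hrs : r ≤ s) (hf : AEStronglyMeasurable f (volume.restrict (Ioc r s)))
    (hi : IntegrableOn (fun t => t ^ k * |f t| ^ (k + 1)) (Ioc r s)) :
    ∫ t in Ioc r s, |f t| ≤
      (∫ t in Ioc r s, t ^ k * |f t| ^ (k + 1)) ^ (1 / (k + 1 : ℝ)) *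
        log (s / r) ^ ((k : ℝ) / (k + 1)) := by
  set μ := volume.restrict (Ioc r s) with hμ
  have hk' : (0 : ℝ) < k := by exact_mod_cast hk
  set p : ℝ := k + 1 with hp
  set q : ℝ := (k + 1) / k with hq
  have hp0 : 0 < p := by positivity
  have hq0 : 0 < q := by positivity
  have hpq : p.HolderConjugate q := by
    rw [Real.holderConjugate_iff]
    refine ⟨by linarith, ?_⟩
    rw [hp, hq]
    field_simp
    ring
  have hpos : ∀ᵐ t ∂μ, 0 < t := by
    filter_upwards [ae_restrict_mem measurableSet_Ioc] with t ht
    exact hr.trans ht.1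
  set F : ℝ → ℝ := fun t => t ^ ((k : ℝ) / (k + 1)) * |f t| with hF
  set G : ℝ → ℝ := fun t => t ^ (-((k : ℝ) / (k + 1))) with hG
  have hFp : ∀ᵐ t ∂μ, F t ^ p = t ^ k * |f t| ^ (k + 1) := by
    filter_upwards [hpos] with t ht
    rw [hF, mul_rpow (by positivity) (abs_nonneg _), ← rpow_mul ht.le, hp,
      div_mul_cancel₀ _ (by positivity), rpow_natCast]
    norm_cast
  have hGq : ∀ᵐ t ∂μ, G t ^ q = t⁻¹ := by
    filter_upwards [hpos] with t ht
    rw [hG, ← rpow_mul ht.le, hq, show -((k : ℝ) / (k + 1)) * ((k + 1) / k) = -1 by field_simp,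
      rpow_neg_one]
  have hF0 : ∀ᵐ t ∂μ, 0 ≤ F t := by
    filter_upwards [hpos] with t ht
    rw [hF]
    positivity
  have hG0 : ∀ᵐ t ∂μ, 0 ≤ G t := by
    filter_upwards [hpos] with t ht
    rw [hG]
    positivity
  have hFm : AEStronglyMeasurable F μ := by
    have h1 : AEStronglyMeasurable (fun t : ℝ => t ^ ((k : ℝ) / (k + 1))) μ :=
      (measurable_id.pow_const _).aestronglyMeasurable
    exact h1.mul hf.norm
  have hGm : AEStronglyMeasurable G μ := (measurable_id.pow_const _).aestronglyMeasurable
  have hinv : IntervalIntegrable (fun t : ℝ => t⁻¹) volume r s := by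
    refine intervalIntegral.intervalIntegrable_inv (fun t ht => ?_) continuousOn_id
    rw [uIcc_of_le hrs] at ht
    exact (hr.trans_le ht.1).ne'
  have hFL : MemLp F (ENNReal.ofReal p) μ := by
    rw [← integrable_norm_rpow_iff hFm (by simpa using hp0) ENNReal.ofReal_ne_top,
      ENNReal.toReal_ofReal hp0.le]
    refine Integrable.congr hi ?_
    filter_upwards [hFp, hF0] with t h1 h2
    rw [norm_of_nonneg h2, h1]
  have hGL : MemLp G (ENNReal.ofReal q) μ := by
    rw [← integrable_norm_rpow_iff hGm (by simpa using hq0) ENNReal.ofReal_ne_top,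
      ENNReal.toReal_ofReal hq0.le]
    refine Integrable.congr ((intervalIntegrable_iff_integrableOn_Ioc_of_le hrs).1 hinv) ?_
    filter_upwards [hGq, hG0] with t h1 h2
    rw [norm_of_nonneg h2, h1]
  have key := integral_mul_le_Lp_mul_Lq_of_nonneg hpq hF0 hG0 hFL hGL
  have hFG : ∫ t, F t * G t ∂μ = ∫ t, |f t| ∂μ := by
    refine integral_congr_ae ?_
    filter_upwards [hpos] with t ht
    have : t ^ ((k : ℝ) / (k + 1)) ≠ 0 := by positivity
    simp only [hF, hG, rpow_neg ht.le]
    field_simp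
  rw [hFG, integral_congr_ae hFp, integral_congr_ae hGq] at key
  rw [hμ, ← intervalIntegral.integral_of_le hrs (f := fun t : ℝ => t⁻¹),
    integral_inv_of_pos hr (hr.trans_le hrs), hq, one_div_div] at key
  exact key

theorem stmt3 (N k : ℕ) (hk : 0 < k) (hN : N = 2 * k) (v v' : ℝ → ℝ)
    (hv : MemX1 N k v v') :
    ∀ r ∈ Ioo (0:ℝ) 1,
      |v r| ≤ normX1 N k v' * (-((N : ℝ) / muN N k) * log r) ^ ((N : ℝ) / (N + 2)) := by
  rintro r ⟨hr0, hr1⟩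
  have hk' : (0 : ℝ) < k := by exact_mod_cast hk
  have hNpos : 0 < N := by omega
  have hNk : N - k = k := by omega
  have hNR : (N : ℝ) = 2 * k := by rw [hN]; push_cast; ring
  have hlog : 0 < -log r := neg_pos.2 (log_neg hr0 hr1)
  set I : ℝ := ∫ t in Ioo (0:ℝ) 1, t ^ k * |v' t| ^ (k + 1) with hI
  have hint := hv.integrableOn_grad
  rw [hNk] at hint
  have hnn : ∀ᵐ t ∂volume.restrict (Ioo (0:ℝ) 1), 0 ≤ t ^ k * |v' t| ^ (k + 1) := by
    filter_upwards [ae_restrict_mem measurableSet_Ioo] with t ht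
    have := ht.1.le
    positivity
  have hI0 : 0 ≤ I := integral_nonneg_of_ae hnn
  have hdiff : ∀ s ∈ Ioo r 1,
      |v s - v r| ≤ I ^ (1 / (k + 1 : ℝ)) * (-log r) ^ ((k : ℝ) / (k + 1)) := by
    rintro s ⟨hrs, hs1⟩
    have hs0 := hr0.trans hrs
    have hsub : Ioc r s ⊆ Ioo (0:ℝ) 1 := fun t ht => ⟨hr0.trans ht.1, ht.2.trans_lt hs1⟩
    have hlog' : log (s / r) ≤ -log r := by
      rw [log_div hs0.ne' hr0.ne']
      linarith [log_neg hs0 hs1]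
    have hlog0 : 0 ≤ log (s / r) := log_nonneg ((one_le_div hr0).2 hrs.le)
    have hIs0 : 0 ≤ ∫ t in Ioc r s, t ^ k * |v' t| ^ (k + 1) :=
      integral_nonneg_of_ae (ae_mono (Measure.restrict_mono_set _ hsub) hnn)
    calc |v s - v r| = |∫ t in r..s, v' t| := by rw [(hv.locAC r ⟨hr0, hr1⟩ s ⟨hs0, hs1⟩).2]
      _ ≤ ∫ t in r..s, |v' t| := intervalIntegral.abs_integral_le_integral_abs hrs.le
      _ = ∫ t in Ioc r s, |v' t| := intervalIntegral.integral_of_le hrs.le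
      _ ≤ _ := setIntegral_abs_le_log hk hr0 hrs.le
          (hv.aestronglyMeasurable_deriv.mono_set hsub) (hint.mono_set hsub)
      _ ≤ _ := by
          gcongr
          exact setIntegral_mono_set hint hnn hsub.eventuallyLE
  have hlim : Tendsto (fun s => |v s - v r|) (nhdsWithin 1 (Iio 1)) (nhds |0 - v r|) :=
    (hv.lim_one.sub_const (v r)).abs
  have hbound : |v r| ≤ I ^ (1 / (k + 1 : ℝ)) * (-log r) ^ ((k : ℝ) / (k + 1)) := by
    rw [zero_sub, abs_neg] at hlim
    exact le_of_tendsto hlim (eventually_of_mem (Ioo_mem_nhdsLT hr1) hdiff)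
  refine hbound.trans_eq ?_
  have hc : 0 < cN N k := cN_pos hNpos (by omega)
  have hratio : -((N : ℝ) / muN N k) * log r = cN N k ^ (-(1 / (k : ℝ))) * -log r := by
    rw [muN_eq_cN hk hNpos, hNR, rpow_neg hc.le,
      show (2 : ℝ) / (2 * k) = 1 / k by field_simp]
    field_simp
  have hexp : (N : ℝ) / (N + 2) = k / (k + 1) := by
    rw [hNR]
    field_simp
  unfold normX1
  rw [hratio, hexp, hNk, ← hI, mul_rpow hc.le hI0, mul_rpow (by positivity) hlog.le,
    ← rpow_mul hc.le, show -(1 / (k : ℝ)) * (k / (k + 1)) = -(1 / (k + 1)) by field_simp,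
    rpow_neg hc.le]
  have : cN N k ^ (1 / (k + 1 : ℝ)) ≠ 0 := by positivity
  field_simp
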